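/- arXiv:1305.4818 — 2 statements merged into one kernel-verified Lean document; each statement's English description precedes it below -/
import Mathlib

section
/- For every z ∈ ℂ with z ≠ 0, the series ∑_{n=0}^∞ j_n(z)² converges and equals Si(2z)/(2z). -/
open Complex

/-- The Rayleigh operator `D`, sending `h` to `z ↦ −h′(z)/z`. -/
noncomputable def rayleighD (h : ℂ → ℂ) : ℂ → ℂ := fun z => -deriv h z / z

/-- The spherical Bessel function of the first kind,
via Rayleigh's formula `j_n(z) = zⁿ (Dⁿ (sin w / w))(z)`. -/
noncomputable def sphj (n : ℕ) (z : ℂ) : ℂ :=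
  z ^ n * (rayleighD^[n] (fun w => Complex.sin w / w)) z

/-- The sine integral `Si(z) = ∑_{n≥0} (−1)ⁿ z^{2n+1}/((2n+1)(2n+1)!)`. -/
noncomputable def sinIntegral (z : ℂ) : ℂ :=
  ∑' n : ℕ, (-1) ^ n * z ^ (2 * n + 1) / ((2 * (n : ℂ) + 1) * ((2 * n + 1).factorial : ℂ))

/-- Power series coefficients of `Dⁿ (sin w / w)`. -/
noncomputable def auxA (n k : ℕ) : ℂ :=
  (-1) ^ k / (2 ^ k * (k.factorial : ℂ) * ((2 * (n + k) + 1).doubleFactorial : ℂ))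

/-- The entire function extending `Dⁿ (sin w / w)`. -/
noncomputable def auxF (n : ℕ) (z : ℂ) : ℂ := ∑' k : ℕ, auxA n k * z ^ (2 * k)

lemma aux_hasSum_congr {f g : ℕ → ℂ} {a : ℂ} (h : ∀ k, f k = g k) : HasSum f a ↔ HasSum g a := by
  rw [funext h]

lemma aux_fact_le (m : ℕ) : m.factorial ≤ (2 * m + 1).doubleFactorial := by
  induction m with
  | zero => simp
  | succ m ih =>
    rw [show 2 * (m + 1) + 1 = (2 * m + 1) + 2 by ring, Nat.doubleFactorial_add_two,
      Nat.factorial_succ]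
    exact Nat.mul_le_mul (by omega) ih

lemma aux_df_ne (m : ℕ) : ((2 * m + 1).doubleFactorial : ℂ) ≠ 0 := by
  exact_mod_cast (Nat.doubleFactorial_pos _).ne'

lemma aux_df_succ (m : ℕ) : ((2 * (m + 1) + 1).doubleFactorial : ℂ)
    = (2 * m + 3) * ((2 * m + 1).doubleFactorial : ℂ) := by
  rw [show 2 * (m + 1) + 1 = (2 * m + 1) + 2 by ring, Nat.doubleFactorial_add_two]
  push_cast; ring

lemma auxA_bound (n k : ℕ) : ‖auxA n k‖ ≤ 1 / (n.factorial : ℝ) * (1 / (k.factorial : ℝ)) := by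
  unfold auxA
  simp only [norm_div, norm_mul, norm_pow, norm_neg, norm_one, one_pow, Complex.norm_natCast,
    Complex.norm_ofNat]
  rw [div_mul_div_comm, one_mul]
  have h1 : (n.factorial : ℝ) ≤ ((2 * (n + k) + 1).doubleFactorial : ℝ) := by
    exact_mod_cast (Nat.factorial_le (Nat.le_add_right n k)).trans (aux_fact_le (n + k))
  have h2 : (1 : ℝ) ≤ 2 ^ k := one_le_pow₀ (by norm_num)
  have h3 : (0 : ℝ) < k.factorial := by exact_mod_cast k.factorial_pos
  have h4 : (0 : ℝ) < n.factorial := by exact_mod_cast n.factorial_pos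
  apply one_div_le_one_div_of_le (by positivity)
  calc (n.factorial : ℝ) * k.factorial = 1 * k.factorial * n.factorial := by ring
    _ ≤ _ := by gcongr

lemma auxT_bound (n k : ℕ) (R : ℝ) (z : ℂ) (hz : ‖z‖ ≤ R) :
    ‖auxA n k * z ^ (2 * k)‖ ≤ 1 / (n.factorial : ℝ) * ((R ^ 2) ^ k / (k.factorial : ℝ)) := by
  rw [norm_mul, norm_pow, pow_mul]
  have hR : 0 ≤ R := (norm_nonneg z).trans hz
  calc _ ≤ (1 / (n.factorial : ℝ) * (1 / (k.factorial : ℝ))) * (R ^ 2) ^ k := by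
        gcongr
        exact auxA_bound n k
    _ = _ := by ring

lemma aux_summable_bd (n : ℕ) (R : ℝ) :
    Summable (fun k : ℕ => 1 / (n.factorial : ℝ) * ((R ^ 2) ^ k / (k.factorial : ℝ))) :=
  (Real.summable_pow_div_factorial _).mul_left _

lemma aux_summable (n : ℕ) (z : ℂ) : Summable (fun k : ℕ => auxA n k * z ^ (2 * k)) :=
  Summable.of_norm_bounded (aux_summable_bd n ‖z‖) (fun k => auxT_bound n k _ z le_rfl)

lemma auxF_bound (n : ℕ) (R : ℝ) (z : ℂ) (hz : ‖z‖ ≤ R) :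
    ‖auxF n z‖ ≤ Real.exp (R ^ 2) / (n.factorial : ℝ) := by
  have h : HasSum (fun k : ℕ => 1 / (n.factorial : ℝ) * ((R ^ 2) ^ k / (k.factorial : ℝ)))
      (1 / (n.factorial : ℝ) * Real.exp (R ^ 2)) := by
    apply HasSum.mul_left
    rw [Real.exp_eq_exp_ℝ]
    exact NormedSpace.expSeries_div_hasSum_exp (R ^ 2)
  calc _ ≤ _ := tsum_of_norm_bounded h (fun k => auxT_bound n k R z hz)
    _ = _ := by ring

lemma auxA_succ (n k : ℕ) : 2 * ((k : ℂ) + 1) * auxA n (k + 1) = - auxA (n + 1) k := by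
  unfold auxA
  rw [show n + 1 + k = n + (k + 1) by ring, Nat.factorial_succ]
  have h1 := aux_df_ne (n + (k + 1))
  have h2 : (k.factorial : ℂ) ≠ 0 := by exact_mod_cast k.factorial_ne_zero
  have h3 : (k : ℂ) + 1 ≠ 0 := by exact_mod_cast k.succ_ne_zero
  push_cast
  field_simp
  ring

lemma auxF_hasDerivAt (n : ℕ) (z : ℂ) : HasDerivAt (auxF n) (-z * auxF (n + 1) z) z := by
  set R := ‖z‖ + 1
  have hU : IsOpen (Metric.ball (0 : ℂ) R) := Metric.isOpen_ball
  have hzU : z ∈ Metric.ball (0 : ℂ) R := by simp [R]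
  have hd : ∀ k : ℕ, DifferentiableOn ℂ (fun w : ℂ => auxA n k * w ^ (2 * k))
      (Metric.ball (0 : ℂ) R) := fun k => by fun_prop
  have hb : ∀ (k : ℕ) (w : ℂ), w ∈ Metric.ball (0 : ℂ) R → ‖auxA n k * w ^ (2 * k)‖ ≤
      1 / (n.factorial : ℝ) * ((R ^ 2) ^ k / (k.factorial : ℝ)) := fun k w hw =>
    auxT_bound n k R w (by simpa using (Metric.mem_ball.1 hw).le)
  have h1 := Complex.hasSum_deriv_of_summable_norm (aux_summable_bd n R) hd hU hb hzU
  have h2 := (Complex.differentiableOn_tsum_of_summable_norm (aux_summable_bd n R) hd hU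
    hb).differentiableAt (hU.mem_nhds hzU)
  have h3 : HasSum (fun k : ℕ => deriv (fun w : ℂ => auxA n k * w ^ (2 * k)) z)
      (-z * auxF (n + 1) z) := by
    rw [← hasSum_nat_add_iff' 1]
    have := (aux_summable (n + 1) z).hasSum.mul_left (-z)
    have e0 : -z * auxF (n + 1) z - ∑ i ∈ Finset.range 1,
        deriv (fun w : ℂ => auxA n i * w ^ (2 * i)) z = -z * auxF (n + 1) z := by simp
    rw [e0]
    refine (aux_hasSum_congr fun k => ?_).mpr this
    · have := auxA_succ n k
      simp only [deriv_const_mul_field, deriv_pow_field]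
      rw [show 2 * (k + 1) - 1 = 2 * k + 1 by omega]
      push_cast
      linear_combination z ^ (2 * k + 1) * this
  have h4 := h2.hasDerivAt
  rw [h1.unique h3] at h4
  exact h4

lemma auxA_rec (n k : ℕ) :
    auxA n (k + 1) + auxA (n + 2) k = (2 * (n : ℂ) + 3) * auxA (n + 1) (k + 1) := by
  unfold auxA
  rw [show n + 2 + k = (n + (k + 1)) + 1 by ring, show n + 1 + (k + 1) = (n + (k + 1)) + 1 by ring,
    aux_df_succ, Nat.factorial_succ]
  have h1 := aux_df_ne (n + (k + 1))
  have h2 : (k.factorial : ℂ) ≠ 0 := by exact_mod_cast k.factorial_ne_zero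
  have h3 : (k : ℂ) + 1 ≠ 0 := by exact_mod_cast k.succ_ne_zero
  have h4 : 2 * ((n : ℂ) + (k + 1)) + 3 ≠ 0 := by
    exact_mod_cast (by omega : 2 * (n + (k + 1)) + 3 ≠ 0)
  push_cast
  field_simp
  ring

lemma auxF_rec (n : ℕ) (z : ℂ) :
    auxF n z + z ^ 2 * auxF (n + 2) z = (2 * (n : ℂ) + 3) * auxF (n + 1) z := by
  have e0 := (aux_summable n z).hasSum
  have e1 := (aux_summable (n + 1) z).hasSum.mul_left (2 * (n : ℂ) + 3)
  have e2 := (aux_summable (n + 2) z).hasSum.mul_left (z ^ 2)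
  rw [← hasSum_nat_add_iff' 1] at e0 e1
  have e3 := e0.add e2
  have : (fun k : ℕ => auxA n (k + 1) * z ^ (2 * (k + 1)) + z ^ 2 * (auxA (n + 2) k * z ^ (2 * k)))
      = fun k : ℕ => (2 * (n : ℂ) + 3) * (auxA (n + 1) (k + 1) * z ^ (2 * (k + 1))) := by
    funext k
    linear_combination z ^ (2 * k + 2) * auxA_rec n k
  rw [this] at e3
  have e4 := e3.unique e1
  have h0 : auxA n 0 = (2 * (n : ℂ) + 3) * auxA (n + 1) 0 := by
    unfold auxA
    have h1 := aux_df_ne n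
    have h4 : 2 * (n : ℂ) + 3 ≠ 0 := by
      exact_mod_cast (by omega : 2 * n + 3 ≠ 0)
    simp only [add_zero]
    rw [aux_df_succ]
    field_simp
  simp only [Finset.sum_range_one, mul_zero, pow_zero, mul_one] at e4
  change auxF n z - _ + z ^ 2 * auxF (n + 2) z = (2 * (n : ℂ) + 3) * auxF (n + 1) z - _ at e4
  linear_combination e4 + h0

lemma auxA_zero (k : ℕ) : auxA 0 k = (-1) ^ k / ((2 * k + 1).factorial : ℂ) := by
  unfold auxA
  rw [Nat.factorial_eq_mul_doubleFactorial, Nat.doubleFactorial_two_mul]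
  push_cast
  rw [zero_add]
  congr 1
  ring

lemma auxF_zero (z : ℂ) : z * auxF 0 z = Complex.sin z := by
  have h := (aux_summable 0 z).hasSum.mul_left z
  refine h.unique ?_
  refine (aux_hasSum_congr fun k => ?_).mpr (Complex.hasSum_sin z)
  rw [auxA_zero]
  ring

lemma auxF_cos (z : ℂ) : Complex.cos z = auxF 0 z - z ^ 2 * auxF 1 z := by
  have h1 := (hasDerivAt_id z).mul (auxF_hasDerivAt 0 z)
  have h2 : (id * auxF 0 : ℂ → ℂ) = Complex.sin := by
    funext w; simpa using auxF_zero w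
  rw [h2] at h1
  have := (Complex.hasDerivAt_sin z).unique h1
  rw [this]; simp; ring

lemma rayleigh_eq (n : ℕ) : ∀ z : ℂ, z ≠ 0 →
    (rayleighD^[n] (fun w => Complex.sin w / w)) z = auxF n z := by
  induction n with
  | zero =>
    intro z hz
    simp only [Function.iterate_zero, id]
    rw [← auxF_zero]; field_simp
  | succ n ih =>
    intro z hz
    rw [Function.iterate_succ_apply']
    unfold rayleighD
    have : (rayleighD^[n] (fun w => Complex.sin w / w)) =ᶠ[nhds z] auxF n := by
      filter_upwards [isOpen_ne.mem_nhds hz] with w hw using ih w hw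
    have h2 := this.deriv_eq
    unfold rayleighD at h2
    rw [h2, (auxF_hasDerivAt n z).deriv]
    field_simp

lemma aux_double (z : ℂ) : auxF 0 (2 * z) = Complex.cos z * auxF 0 z := by
  by_cases hz : z = 0
  · simp [hz]
  · have h1 := auxF_zero (2 * z)
    rw [Complex.sin_two_mul, ← auxF_zero z] at h1
    have : (2 * z) ≠ 0 := by simp [hz]
    apply mul_left_cancel₀ this
    linear_combination h1

/-- The term of `sinIntegral`. -/
lemma sinTerm_eq (n : ℕ) (z : ℂ) :
    (-1) ^ n * z ^ (2 * n + 1) / ((2 * (n : ℂ) + 1) * ((2 * n + 1).factorial : ℂ))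
    = auxA 0 n / (2 * (n : ℂ) + 1) * z ^ (2 * n + 1) := by
  rw [auxA_zero, div_div]
  ring

lemma sinInt_hasDerivAt (z : ℂ) : HasDerivAt sinIntegral (auxF 0 z) z := by
  set R := ‖z‖ + 1
  have hU : IsOpen (Metric.ball (0 : ℂ) R) := Metric.isOpen_ball
  have hzU : z ∈ Metric.ball (0 : ℂ) R := by simp [R]
  have hne : ∀ k : ℕ, (2 * (k : ℂ) + 1) ≠ 0 := fun k => by
    exact_mod_cast (by omega : 2 * k + 1 ≠ 0)
  have hd : ∀ k : ℕ, DifferentiableOn ℂ (fun w : ℂ => auxA 0 k / (2 * (k : ℂ) + 1) * w ^ (2 * k + 1))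
      (Metric.ball (0 : ℂ) R) := fun k => by fun_prop
  have hb : ∀ (k : ℕ) (w : ℂ), w ∈ Metric.ball (0 : ℂ) R →
      ‖auxA 0 k / (2 * (k : ℂ) + 1) * w ^ (2 * k + 1)‖ ≤
      1 / ((0 : ℕ).factorial : ℝ) * ((R ^ 2) ^ k / (k.factorial : ℝ)) * R := fun k w hw => by
    have hw' : ‖w‖ ≤ R := by simpa using (Metric.mem_ball.1 hw).le
    have h1 := auxT_bound 0 k R w hw'
    have h2 : (1 : ℝ) ≤ ‖(2 * (k : ℂ) + 1)‖ := by
      have : (2 * (k : ℂ) + 1) = ((2 * k + 1 : ℕ) : ℂ) := by push_cast; ring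
      rw [this, Complex.norm_natCast]
      exact_mod_cast (by omega : 1 ≤ 2 * k + 1)
    have h3 : auxA 0 k / (2 * (k : ℂ) + 1) * w ^ (2 * k + 1)
        = (auxA 0 k * w ^ (2 * k)) * w / (2 * (k : ℂ) + 1) := by ring
    rw [h3, norm_div, norm_mul (auxA 0 k * w ^ (2 * k))]
    refine (div_le_self (by positivity) h2).trans ?_
    exact mul_le_mul h1 hw' (norm_nonneg _) ((norm_nonneg _).trans h1)
  have hs := (aux_summable_bd 0 R).mul_right R
  have h1 := Complex.hasSum_deriv_of_summable_norm hs hd hU hb hzU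
  have h2 := (Complex.differentiableOn_tsum_of_summable_norm hs hd hU
    hb).differentiableAt (hU.mem_nhds hzU)
  have h3 : HasSum (fun k : ℕ => deriv (fun w : ℂ => auxA 0 k / (2 * (k : ℂ) + 1) *
      w ^ (2 * k + 1)) z) (auxF 0 z) := by
    have := (aux_summable 0 z).hasSum
    refine (aux_hasSum_congr fun k => ?_).mpr this
    simp only [deriv_const_mul_field, deriv_pow_field]
    have := hne k
    push_cast
    field_simp
  have h4 := h2.hasDerivAt
  rw [h1.unique h3] at h4
  have h5 : sinIntegral = fun w => ∑' k : ℕ, auxA 0 k / (2 * (k : ℂ) + 1) * w ^ (2 * k + 1) := by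
    funext w
    unfold sinIntegral
    exact tsum_congr fun k => sinTerm_eq k w
  rw [h5]
  exact h4

lemma sinInt_zero : sinIntegral 0 = 0 := by
  simp [sinIntegral]

lemma term_hasDerivAt (n : ℕ) (z : ℂ) : HasDerivAt (fun w : ℂ => w ^ (2 * n + 1) * auxF n w ^ 2)
    ((2 * (n : ℂ) + 1) * z ^ (2 * n) * auxF n z ^ 2
      - 2 * z ^ (2 * n + 2) * auxF n z * auxF (n + 1) z) z := by
  have h := (hasDerivAt_pow (2 * n + 1) z).mul ((auxF_hasDerivAt n z).pow 2)
  refine h.congr_deriv ?_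
  simp
  ring

lemma partial_hasDerivAt (N : ℕ) (z : ℂ) :
    HasDerivAt (fun w : ℂ => ∑ n ∈ Finset.range (N + 1), w ^ (2 * n + 1) * auxF n w ^ 2)
    (Complex.cos z * auxF 0 z - z ^ (2 * N + 2) * auxF N z * auxF (N + 1) z) z := by
  induction N with
  | zero =>
    have h := term_hasDerivAt 0 z
    simp only [zero_add, Finset.sum_range_one]
    refine HasDerivAt.congr_deriv (by simpa using h) ?_
    rw [auxF_cos]
    simp
    ring
  | succ N ih =>
    have h := ih.add (term_hasDerivAt (N + 1) z)
    simp only [Finset.sum_range_succ _ (N + 1)]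
    refine HasDerivAt.congr_deriv h ?_
    have := auxF_rec N z
    push_cast
    linear_combination (-z ^ (2 * N + 2) * auxF (N + 1) z) * this

lemma remainder_bound (N : ℕ) (z : ℂ) :
    ‖sinIntegral (2 * z) / 2 - ∑ n ∈ Finset.range (N + 1), z ^ (2 * n + 1) * auxF n z ^ 2‖
    ≤ (‖z‖ ^ 2) ^ (N + 1) / ((N + 1).factorial : ℝ) * (Real.exp (‖z‖ ^ 2) ^ 2 * ‖z‖) := by
  have hd : ∀ w : ℂ, HasDerivAt (fun w : ℂ => sinIntegral (2 * w) / 2 -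
      ∑ n ∈ Finset.range (N + 1), w ^ (2 * n + 1) * auxF n w ^ 2)
      (w ^ (2 * N + 2) * auxF N w * auxF (N + 1) w) w := by
    intro w
    have h1 : HasDerivAt (fun w : ℂ => sinIntegral (2 * w) / 2) (auxF 0 (2 * w)) w := by
      have h := (HasDerivAt.comp w (sinInt_hasDerivAt (2 * w))
        ((hasDerivAt_id w).const_mul 2)).div_const 2
      refine HasDerivAt.congr_deriv h ?_
      ring
    refine (h1.sub (partial_hasDerivAt N w)).congr_deriv ?_
    rw [aux_double]; ring
  have key := (convex_closedBall (0 : ℂ) ‖z‖).norm_image_sub_le_of_norm_hasDerivWithin_le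
    (C := (‖z‖ ^ 2) ^ (N + 1) / ((N + 1).factorial : ℝ) * (Real.exp (‖z‖ ^ 2) ^ 2))
    (fun w _ => (hd w).hasDerivWithinAt) ?_ (x := 0) (y := z) (by simp) (by simp)
  · simpa [sinInt_zero, mul_assoc] using key
  · intro w hw
    have hw' : ‖w‖ ≤ ‖z‖ := by simpa using hw
    have b1 := auxF_bound N _ w hw'
    have b2 := auxF_bound (N + 1) _ w hw'
    have b3 : Real.exp (‖z‖ ^ 2) / (N.factorial : ℝ) ≤ Real.exp (‖z‖ ^ 2) :=
      div_le_self (Real.exp_pos _).le (by exact_mod_cast N.factorial_pos)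
    rw [norm_mul, norm_mul, norm_pow]
    calc _ ≤ ‖z‖ ^ (2 * N + 2) * Real.exp (‖z‖ ^ 2) *
          (Real.exp (‖z‖ ^ 2) / ((N + 1).factorial : ℝ)) := by
          gcongr
          exact b1.trans b3
      _ = _ := by
          rw [← pow_mul]; ring

lemma sphj_eq (n : ℕ) (z : ℂ) (hz : z ≠ 0) : sphj n z ^ 2 = z ^ (2 * n) * auxF n z ^ 2 := by
  unfold sphj
  rw [rayleigh_eq n z hz]; ring

lemma sphj_summable (z : ℂ) (hz : z ≠ 0) : Summable (fun n : ℕ => (sphj n z) ^ 2) := by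
  apply Summable.of_norm_bounded
    (g := fun n : ℕ => (‖z‖ ^ 2) ^ n / (n.factorial : ℝ) * (Real.exp (‖z‖ ^ 2) ^ 2))
  · exact (Real.summable_pow_div_factorial _).mul_right _
  · intro n
    rw [sphj_eq n z hz, norm_mul, norm_pow, norm_pow, pow_mul]
    have b1 := auxF_bound n _ z le_rfl
    have b3 : Real.exp (‖z‖ ^ 2) / (n.factorial : ℝ) ≤ Real.exp (‖z‖ ^ 2) :=
      div_le_self (Real.exp_pos _).le (by exact_mod_cast n.factorial_pos)
    calc _ = (‖z‖ ^ 2) ^ n * (‖auxF n z‖ * ‖auxF n z‖) := by ring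
      _ ≤ (‖z‖ ^ 2) ^ n * (Real.exp (‖z‖ ^ 2) / (n.factorial : ℝ) * Real.exp (‖z‖ ^ 2)) := by
          gcongr
          exact b1.trans b3
      _ = _ := by ring

theorem stmt15 (z : ℂ) (hz : z ≠ 0) :
    HasSum (fun n : ℕ => (sphj n z) ^ 2) (sinIntegral (2 * z) / (2 * z)) := by
  have hs := sphj_summable z hz
  have ht := (hs.hasSum.tendsto_sum_nat.comp (Filter.tendsto_add_atTop_nat 1)).const_mul z
  have hr : Filter.Tendsto (fun N : ℕ => sinIntegral (2 * z) / 2 -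
      ∑ n ∈ Finset.range (N + 1), z ^ (2 * n + 1) * auxF n z ^ 2) Filter.atTop (nhds 0) := by
    apply squeeze_zero_norm (fun N => remainder_bound N z)
    have := ((FloorSemiring.tendsto_pow_div_factorial_atTop (‖z‖ ^ 2)).comp
      (Filter.tendsto_add_atTop_nat 1)).mul_const (Real.exp (‖z‖ ^ 2) ^ 2 * ‖z‖)
    simpa using this
  have hr2 := hr.const_sub (sinIntegral (2 * z) / 2)
  have he : z * ∑' n : ℕ, (sphj n z) ^ 2 = sinIntegral (2 * z) / 2 - 0 := by
    refine tendsto_nhds_unique ht (hr2.congr fun N => ?_)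
    simp only [Function.comp, sub_sub_cancel, Finset.mul_sum]
    refine Finset.sum_congr rfl fun n _ => ?_
    rw [sphj_eq n z hz]; ring
  have hv : sinIntegral (2 * z) / (2 * z) = ∑' n : ℕ, (sphj n z) ^ 2 := by
    rw [sub_zero] at he
    rw [div_eq_iff (by simp [hz])]
    linear_combination (-2) * he
  rw [hv]
  exact hs.hasSum
end

section
/- For every z ∈ ℂ with z ≠ 0 and every θ ∈ ℂ, J₀(z·sin θ) = ∑_{n=0}^∞ (4n+1) · ((2n)! / (2^{2n}·(n!)²)) · j_{2n}(z) · P_{2n}(cos θ), where J₀(w) = ∑_{k=0}^∞ (−1)^k (w/2)^{2k}/(k!)² is the (entire) Bessel function of order 0. -/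
open Complex

/-- The Bessel function of order 0, `J₀(w) = ∑_{k≥0} (−1)ᵏ (w/2)^{2k}/(k!)²`. -/
noncomputable def besselJ0 (w : ℂ) : ℂ :=
  ∑' k : ℕ, (-1) ^ k * (w / 2) ^ (2 * k) / ((k.factorial : ℂ)) ^ 2

/-- The `m`-th Legendre polynomial at a complex argument, via Rodrigues' formula
`P_m(x) = (1/(2^m m!)) dᵐ/dxᵐ (x²−1)ᵐ`. -/
noncomputable def legendreC (m : ℕ) (x : ℂ) : ℂ :=
  ((Polynomial.derivative^[m] ((Polynomial.X ^ 2 - 1 : Polynomial ℂ) ^ m)).eval x) /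
    (2 ^ m * (m.factorial : ℂ))

open Polynomial

noncomputable def Q (m : ℕ) : ℂ[X] := derivative^[m] ((X ^ 2 - 1 : ℂ[X]) ^ m)
noncomputable def T (p : ℂ[X]) : ℂ[X] := (1 - X^2) * derivative (derivative p) - 2 * X * derivative p

lemma rodr (m k : ℕ) : (X^2-1 : ℂ[X]) * derivative^[k+2] ((X ^ 2 - 1 : ℂ[X]) ^ m)
   + (2 * ((k:ℂ[X])+1-(m:ℂ[X]))) * X * derivative^[k+1] ((X ^ 2 - 1 : ℂ[X]) ^ m)
   + (((k:ℂ[X])+1)*(k:ℂ[X]) - 2*(m:ℂ[X])*((k:ℂ[X])+1)) * derivative^[k] ((X ^ 2 - 1 : ℂ[X]) ^ m) = 0 := by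
  induction k with
  | zero =>
    have h : (X^2-1 : ℂ[X]) * derivative ((X ^ 2 - 1 : ℂ[X]) ^ m) = 2 * (m:ℂ[X]) * X * (X ^ 2 - 1 : ℂ[X]) ^ m := by
      rcases m with _ | m
      · simp
      · rw [derivative_pow]; simp; ring
    have h2 := congrArg derivative h
    simp only [derivative_mul, derivative_sub, derivative_X_pow, derivative_one, derivative_natCast, derivative_X, derivative_ofNat] at h2
    simp only [zero_add, Function.iterate_succ_apply', Function.iterate_zero_apply]
    simp [C_ofNat] at h2 ⊢
    linear_combination h2
  | succ k ih =>
    have h2 := congrArg derivative ih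
    simp only [Function.iterate_succ_apply'] at h2 ⊢
    simp [C_ofNat] at h2 ⊢
    linear_combination h2

lemma T_Q (m : ℕ) : T (Q m) = - ((m:ℂ[X])*(m+1)) * Q m := by
  have := rodr m m
  simp only [T, Q, Function.iterate_succ_apply'] at this ⊢
  linear_combination -this

lemma T_u (N : ℕ) : T ((1-X^2 : ℂ[X])^(N+1)) = 4*((N:ℂ[X])+1)^2 * (1-X^2 : ℂ[X])^N - 2*((N:ℂ[X])+1)*(2*(N:ℂ[X])+3)*(1-X^2 : ℂ[X])^(N+1) := by
  have h : ∀ N : ℕ, derivative ((1-X^2 : ℂ[X])^(N+1)) = -2*((N:ℂ[X])+1)*X*(1-X^2)^N := by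
    intro N; rw [derivative_pow]; simp; ring
  rw [T, h]
  rcases N with _ | N
  · simp; ring
  · simp only [derivative_mul, h]
    simp
    ring

lemma T_coeff (p : ℂ[X]) (d : ℕ) : (T p).coeff d = (d+2)*(d+1)*p.coeff (d+2) - d*(d+1)*p.coeff d := by
  rw [T, sub_mul, one_mul, mul_assoc, ← C_ofNat, coeff_sub, coeff_sub, coeff_C_mul, pow_two, mul_assoc]
  rcases d with _ | _ | d
  · simp [coeff_derivative]; ring
  · simp [coeff_derivative, coeff_X_mul]; ring
  · simp [coeff_derivative, coeff_X_mul]; ring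

lemma T_ker (M : ℕ) (p : ℂ[X]) (h1 : p.natDegree ≤ M) (h2 : p.coeff M = 0)
   (h : T p + (M:ℂ[X])*(M+1) * p = 0) : p = 0 := by
  by_contra hp
  have hl : p.coeff p.natDegree ≠ 0 := by simpa using hp
  have hlt : p.natDegree < M := lt_of_le_of_ne h1 (by rintro h; rw [h] at hl; exact hl h2)
  have h3 := congrArg (fun q => q.coeff p.natDegree) h
  have e : (M:ℂ[X])*(M+1) * p = C ((M:ℂ)*(M+1)) * p := by simp
  simp only [e, coeff_add, T_coeff, coeff_C_mul, coeff_zero] at h3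
  rw [coeff_eq_zero_of_natDegree_lt (by omega : p.natDegree < p.natDegree+2)] at h3
  set d := p.natDegree
  have h4 : ((M:ℂ) - d) * (M+d+1) * p.coeff d = 0 := by linear_combination h3
  rcases mul_eq_zero.1 h4 with h5 | h5
  · rcases mul_eq_zero.1 h5 with h6 | h6
    · have : (M:ℂ) = d := by linear_combination h6
      have := Nat.cast_injective this
      omega
    · norm_cast at h6
  · exact hl h5

lemma T_add (p q) : T (p+q) = T p + T q := by simp [T]; ring
lemma T_neg (p) : T (-p) = - T p := by simp [T]; ring
lemma T_C (c p) : T (C c * p) = C c * T p := by simp [T]; ring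
lemma T_sum (s : Finset ℕ) (f : ℕ → ℂ[X]) : T (∑ i ∈ s, f i) = ∑ i ∈ s, T (f i) := by
  induction s using Finset.induction_on with
  | empty => simp [T]
  | insert a s ha ih => rw [Finset.sum_insert ha, Finset.sum_insert ha, T_add, ih]

noncomputable def aC (N n : ℕ) : ℂ := (-1)^n * 4^N * (N.factorial:ℂ)^2 * (4*n+1) /
  (16^n * (n.factorial:ℂ)^2 * 2^(N-n) * ((N-n).factorial:ℂ) * (Nat.doubleFactorial (2*N+2*n+1) : ℂ))

lemma df_ne (n : ℕ) : (Nat.doubleFactorial n : ℂ) ≠ 0 := by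
  exact_mod_cast (Nat.doubleFactorial_pos n).ne'

lemma aC_succ (N n : ℕ) (h : n ≤ N) : aC (N+1) n * (2*(N+1-n)*(2*N+2*n+3)) = 4*(N+1)^2 * aC N n := by
  obtain ⟨k, rfl⟩ := Nat.exists_eq_add_of_le h
  have e : n + k + 1 - n = k+1 := by omega
  have e2 : 2*(n+k+1)+2*n+1 = (2*(n+k)+2*n+1)+2 := by ring
  rw [aC, aC, e, e2, Nat.doubleFactorial_add_two, Nat.add_sub_cancel_left, Nat.factorial_succ, Nat.factorial_succ]
  have := df_ne (2*(n+k)+2*n+1)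
  have h1 : (n.factorial:ℂ) ≠ 0 := by exact_mod_cast n.factorial_ne_zero
  have h2 : (k.factorial:ℂ) ≠ 0 := by exact_mod_cast k.factorial_ne_zero
  rw [div_mul_eq_mul_div, mul_div_assoc', div_eq_div_iff]
  · push_cast
    ring
  · simp only [ne_eq, mul_eq_zero, Nat.cast_eq_zero, Nat.cast_mul] at *
    simp_all
  · simp [h1, h2, this]

lemma Q_deg (m : ℕ) : (Q m).natDegree ≤ m := by
  refine (natDegree_iterate_derivative _ _).trans ?_
  have : ((X^2-1 : ℂ[X])^m).natDegree ≤ m * 2 := by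
    refine natDegree_pow_le_of_le m ?_
    compute_degree
  omega

lemma Q_lead (m : ℕ) : (Q m).coeff m * m.factorial = (2*m).factorial := by
  rw [Q, coeff_iterate_derivative]
  have : ((X^2-1 : ℂ[X])^m).coeff (m+m) = 1 := by
    have h : (X^2-1 : ℂ[X]).Monic := by monicity!
    have h2 : (X^2-1 : ℂ[X]).natDegree = 2 := by compute_degree!
    have := (h.pow m).coeff_natDegree
    rwa [natDegree_pow, h2, mul_two] at this
  rw [this]
  have := Nat.factorial_mul_descFactorial (show m ≤ m+m by omega)
  rw [Nat.add_sub_cancel] at this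
  rw [two_mul, ← this]
  push_cast; simp; ring

lemma aC_self (N : ℕ) : aC N N * (Q (2*N)).coeff (2*N) = (-1)^N := by
  have h := Q_lead (2*N)
  have h1 : (N.factorial:ℂ) ≠ 0 := by exact_mod_cast N.factorial_ne_zero
  have h2 : ((2*N).factorial:ℂ) ≠ 0 := by exact_mod_cast (2*N).factorial_ne_zero
  have h3 := df_ne (2*N+2*N+1)
  have h4 := Nat.factorial_eq_mul_doubleFactorial (2*(2*N))
  rw [Nat.doubleFactorial_two_mul, Nat.factorial_succ] at h4
  have h5 : ((2*(2*N)+1 : ℂ)) * (2*(2*N)).factorial = (Nat.doubleFactorial (2*N+2*N+1)) * (2^(2*N) * (2*N).factorial) := by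
    rw [show 2*N+2*N+1 = 2*(2*N)+1 by ring]
    exact_mod_cast h4
  rw [← h] at h5
  have h6 : (4*N+1) * (Q (2*N)).coeff (2*N) = (Nat.doubleFactorial (2*N+2*N+1)) * 4^N := by
    apply mul_right_cancel₀ h2
    rw [pow_mul] at h5; norm_num at h5
    linear_combination h5
  rw [aC, Nat.sub_self, div_mul_eq_mul_div, div_eq_iff (by simp [h1,h3])]
  simp only [pow_zero, Nat.factorial_zero, Nat.cast_one, mul_one]
  rw [show (16:ℂ)^N = 4^N*4^N by rw [← mul_pow]; norm_num]
  linear_combination (-1)^N * 4^N * (N.factorial:ℂ)^2 * h6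

lemma main_poly (N : ℕ) : (1-X^2 : ℂ[X])^N = ∑ n ∈ Finset.range (N+1), C (aC N n) * Q (2*n) := by
  induction N with
  | zero => simp [aC, Q]
  | succ N ih =>
    rw [← sub_eq_zero]
    have hd : ((1-X^2 : ℂ[X])^(N+1)).natDegree ≤ 2*(N+1) := by
      rw [mul_comm]
      refine natDegree_pow_le_of_le _ ?_
      compute_degree
    apply T_ker (2*(N+1))
    · refine (natDegree_sub_le_of_le hd (n := 2*(N+1)) ?_).trans (by simp)
      apply natDegree_sum_le_of_forall_le
      intro n hn
      refine (natDegree_C_mul_le _ _).trans ((Q_deg _).trans ?_)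
      have := Finset.mem_range.1 hn
      omega
    · rw [Finset.sum_range_succ, coeff_sub, coeff_add, coeff_C_mul, aC_self, finsetSum_coeff, Finset.sum_eq_zero]
      · have h2 : (1-X^2 : ℂ[X]) = - (X^2-1) := by ring
        have h : (X^2-1 : ℂ[X]).Monic := by monicity!
        have h3 : (X^2-1 : ℂ[X]).natDegree = 2 := by compute_degree!
        have := (h.pow (N+1)).coeff_natDegree
        rw [natDegree_pow, h3, mul_comm] at this
        rw [h2, neg_pow, ← C_1, ← C_neg, ← C_pow, coeff_C_mul, C_1, this]
        simp
      · intro n hn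
        have := Finset.mem_range.1 hn
        rw [coeff_C_mul, coeff_eq_zero_of_natDegree_lt ((Q_deg _).trans_lt (by omega)), mul_zero]
    · rw [sub_eq_add_neg, T_add, T_neg, T_u, ih, T_sum, Finset.sum_range_succ _ (N+1), T_C, T_Q]
      rw [Finset.sum_range_succ _ (N+1)]
      have : ∑ n ∈ Finset.range (N+1), T (C (aC (N+1) n) * Q (2*n)) = 
        4*((N:ℂ[X])+1)^2 * ∑ n ∈ Finset.range (N+1), C (aC N n) * Q (2*n) - 
         2*((N:ℂ[X])+1)*(2*(N:ℂ[X])+3) * ∑ n ∈ Finset.range (N+1), C (aC (N+1) n) * Q (2*n) := by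
        rw [Finset.mul_sum, Finset.mul_sum, ← Finset.sum_sub_distrib]
        refine Finset.sum_congr rfl fun n hn => ?_
        have h := congrArg C (aC_succ N n (by have := Finset.mem_range.1 hn; omega))
        simp only [C_mul, C_add, C_sub, C_pow, C_ofNat, C_1, C_eq_natCast, map_natCast] at h
        rw [T_C, T_Q]
        push_cast
        linear_combination Q (2*n) * h
      rw [this]
      push_cast
      ring

noncomputable def jt (m k : ℕ) (z : ℂ) : ℂ :=
  (-1)^k * z^(2*k) / (2^k * (k.factorial:ℂ) * (Nat.doubleFactorial (2*m+2*k+1) : ℂ))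

lemma jt_bound (m k : ℕ) (z : ℂ) (B : ℕ) (h : B ≤ Nat.doubleFactorial (2*m+2*k+1)) (hB : 0 < B) :
    ‖jt m k z‖ ≤ (‖z‖^2)^k / k.factorial * (1 / B) := by
  rw [jt]
  simp only [norm_div, norm_mul, norm_pow, norm_neg, norm_one, one_pow, one_mul, Complex.norm_natCast, Complex.norm_ofNat]
  rw [← pow_mul, div_mul_div_comm, mul_one]
  have h1 : (B:ℝ) ≤ Nat.doubleFactorial (2*m+2*k+1) := by exact_mod_cast h
  have h2 : (1:ℝ) ≤ 2^k := one_le_pow₀ (by norm_num)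
  have h3 : (0:ℝ) < k.factorial := by exact_mod_cast k.factorial_pos
  have h4 : (0:ℝ) < B := by exact_mod_cast hB
  gcongr
  nlinarith

lemma exp_summable (x : ℝ) : Summable (fun k : ℕ => x^k / k.factorial) := Real.summable_pow_div_factorial x

lemma jt_bound' (m k : ℕ) (z : ℂ) : ‖jt m k z‖ ≤ (‖z‖^2)^k / k.factorial := by
  have := jt_bound m k z 1 (Nat.doubleFactorial_pos _) one_pos
  simpa using this

lemma jt_summable (m : ℕ) (z : ℂ) : Summable (fun k => jt m k z) :=
  Summable.of_norm_bounded (exp_summable (‖z‖^2)) (fun k => jt_bound' m k z)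

noncomputable def jF (m : ℕ) (z : ℂ) : ℂ := ∑' k, jt m k z

lemma jt_deriv_zero (m : ℕ) (z : ℂ) : deriv (jt m 0) z = 0 := by
  have : jt m 0 = fun _ => 1 / (Nat.doubleFactorial (2*m+1) : ℂ) := by
    funext w; simp [jt]
  rw [this]; simp

lemma jt_deriv_succ (m k : ℕ) (z : ℂ) : deriv (jt m (k+1)) z = - z * jt (m+1) k z := by
  have : HasDerivAt (jt m (k+1)) ((-1)^(k+1) * ((2*(k+1) : ℕ) * z^(2*(k+1)-1)) / (2^(k+1) * ((k+1).factorial:ℂ) * (Nat.doubleFactorial (2*m+2*(k+1)+1) : ℂ))) z := by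
    exact ((hasDerivAt_pow (2*(k+1)) z).const_mul _).div_const _
  rw [this.deriv, jt, show 2*m+2*(k+1)+1 = 2*(m+1)+2*k+1 by ring, Nat.factorial_succ, show 2*(k+1)-1 = 2*k+1 by omega]
  have h1 := df_ne (2*(m+1)+2*k+1)
  have h2 : (k.factorial:ℂ) ≠ 0 := by exact_mod_cast k.factorial_ne_zero
  have h3 : ((k:ℂ)+1) ≠ 0 := by exact_mod_cast k.succ_ne_zero
  push_cast
  field_simp
  ring

lemma jF_deriv (m : ℕ) (z : ℂ) : deriv (jF m) z = - z * jF (m+1) z := by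
  have h := Complex.hasSum_deriv_of_summable_norm (F := fun k => jt m k) (U := Metric.ball 0 (‖z‖+1)) (z := z)
    (exp_summable ((‖z‖+1)^2)) (fun k => by
      apply Differentiable.differentiableOn
      unfold jt
      fun_prop) Metric.isOpen_ball (fun k w hw => by
        refine (jt_bound' m k w).trans ?_
        have : ‖w‖ < ‖z‖+1 := by simpa using hw
        gcongr) (by simp)
  have h2 : HasSum (fun k => deriv (jt m k) z) (- z * jF (m+1) z) := by
    rw [← hasSum_nat_add_iff' 1]
    simp only [Finset.range_one, Finset.sum_singleton, jt_deriv_zero, sub_zero, jt_deriv_succ]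
    exact (jt_summable (m+1) z).hasSum.mul_left _
  exact h.unique h2

lemma jF_zero (z : ℂ) (hz : z ≠ 0) : sin z / z = jF 0 z := by
  have h := (Complex.hasSum_sin z).div_const z
  rw [← h.tsum_eq, jF]
  congr 1
  funext k
  rw [jt, Nat.factorial_eq_mul_doubleFactorial, Nat.doubleFactorial_two_mul]
  have h1 := df_ne (2*k+1)
  have h2 : (k.factorial:ℂ) ≠ 0 := by exact_mod_cast k.factorial_ne_zero
  simp only [mul_zero, zero_add]
  push_cast
  field_simp
  ring

lemma ray_iter (n : ℕ) : ∀ z : ℂ, z ≠ 0 → (rayleighD^[n] (fun w => Complex.sin w / w)) z = jF n z := by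
  induction n with
  | zero => intro z hz; exact jF_zero z hz
  | succ n ih =>
    intro z hz
    rw [Function.iterate_succ_apply', rayleighD]
    have : (rayleighD^[n] (fun w => Complex.sin w / w)) =ᶠ[nhds z] jF n := by
      filter_upwards [isOpen_ne.mem_nhds hz] with w hw using ih w hw
    rw [this.deriv_eq, jF_deriv]
    field_simp

lemma leg_bound (m : ℕ) (x : ℂ) (R : ℝ) (hR : 1 ≤ R) (hx : ‖x‖ ≤ R) : ‖legendreC m x‖ ≤ (4*R)^m := by
  have e : (X^2-1 : ℂ[X])^m = ∑ i ∈ Finset.range (m+1), C ((-1)^(m-i) * (m.choose i : ℂ)) * X^(2*i) := by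
    rw [sub_eq_add_neg, add_pow]
    refine Finset.sum_congr rfl fun i _ => ?_
    rw [← pow_mul]; simp; ring
  have hm : (0:ℝ) < m.factorial := by exact_mod_cast m.factorial_pos
  rw [legendreC, norm_div, div_le_iff₀ (by simp [Nat.factorial_pos]), e, iterate_derivative_sum, eval_finsetSum]
  refine (norm_sum_le_of_le (f := _) _ (n := fun i => (m.choose i : ℝ) * (m.factorial * 4^m * R^m)) ?_).trans ?_
  · intro i hi
    have hi := Finset.mem_range.1 hi
    rw [iterate_derivative_C_mul, iterate_derivative_X_pow_eq_smul]
    simp only [eval_mul, eval_C, eval_smul, eval_pow, eval_X, norm_mul, norm_pow, norm_neg, norm_one, one_pow, one_mul, smul_eq_mul, Complex.norm_natCast, nsmul_eq_mul]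
    have h1 : ((2*i).descFactorial m : ℝ) ≤ m.factorial * 4^m := by
      rw [Nat.descFactorial_eq_factorial_mul_choose]
      have : (2*i).choose m ≤ 4^m := by
        refine (Nat.choose_le_two_pow _ _).trans ?_
        rw [pow_mul]
        exact Nat.pow_le_pow_right (by norm_num) (by omega)
      push_cast
      gcongr
      exact_mod_cast this
    have h2 : ‖x‖^(2*i-m) ≤ R^m := (pow_le_pow_left₀ (norm_nonneg _) hx _).trans (pow_le_pow_right₀ hR (by omega))
    gcongr
  · rw [← Finset.sum_mul]
    have : (∑ i ∈ Finset.range (m+1), (m.choose i : ℝ)) = 2^m := by exact_mod_cast Nat.sum_range_choose m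
    rw [this]
    simp
    rw [mul_pow]
    exact le_of_eq (by ring)

lemma df_bound (m k : ℕ) : (2*m+1) * m.factorial ≤ Nat.doubleFactorial (2*m+2*k+1) := by
  induction k with
  | zero =>
    induction m with
    | zero => simp
    | succ m ih =>
      rw [show 2*(m+1)+2*0+1 = (2*m+2*0+1)+2 by ring, Nat.doubleFactorial_add_two, Nat.factorial_succ]
      have : (m+1) * m.factorial ≤ (2*m+1) * m.factorial := Nat.mul_le_mul_right _ (by omega)
      exact Nat.mul_le_mul (by omega) (this.trans ih)
  | succ k ih =>
    rw [show 2*m+2*(k+1)+1 = (2*m+2*k+1)+2 by ring, Nat.doubleFactorial_add_two]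
    exact ih.trans (Nat.le_mul_of_pos_left _ (by omega))

noncomputable def cc (n : ℕ) : ℂ := (((2 * n).factorial : ℂ) / (2 ^ (2 * n) * ((n.factorial : ℂ)) ^ 2))

lemma cc_bound (n : ℕ) : ‖cc n‖ ≤ 1 := by
  rw [cc]
  simp only [norm_div, norm_mul, norm_pow, Complex.norm_natCast, Complex.norm_ofNat]
  have h3 : (0:ℝ) < n.factorial := by exact_mod_cast n.factorial_pos
  rw [div_le_one (by positivity)]
  have h := Nat.choose_mul_factorial_mul_factorial (show n ≤ 2*n by omega)
  rw [show 2*n-n = n by omega] at h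
  rw [← h]
  have : ((2*n).choose n : ℝ) ≤ 2^(2*n) := by exact_mod_cast Nat.choose_le_two_pow _ _
  push_cast
  rw [mul_assoc, ← pow_two]
  gcongr

noncomputable def tt (z x : ℂ) (p : ℕ × ℕ) : ℂ :=
  (4 * (p.1 : ℂ) + 1) * cc p.1 * (z^(2*p.1) * jt (2*p.1) p.2 z) * legendreC (2*p.1) x

lemma tt_summable (z x : ℂ) : Summable (tt z x) := by
  set R := max 1 ‖x‖
  have hs : Summable (fun n : ℕ => (4*R*‖z‖)^(2*n) / (2*n).factorial) :=
    (exp_summable (4*R*‖z‖)).comp_injective (i := fun n : ℕ => 2*n) (fun a b h => by simpa using h)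
  have hR : 1 ≤ R := le_max_left _ _
  refine Summable.of_norm_bounded (hs.mul_of_nonneg (exp_summable (‖z‖^2)) ?_ ?_) ?_
  · intro n; positivity
  · intro n; positivity
  · rintro ⟨n, k⟩
    have h1 := jt_bound (2*n) k z _ (df_bound (2*n) k) (by positivity)
    have h2 := leg_bound (2*n) x R hR (le_max_right _ _)
    have h3 := cc_bound n
    have h4 : ‖(4*(n:ℂ)+1)‖ = 4*n+1 := by
      have : (4*(n:ℂ)+1) = ((4*n+1 : ℕ) : ℂ) := by push_cast; ring
      rw [this, Complex.norm_natCast]; push_cast; ring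
    simp only [tt, norm_mul, norm_pow, h4]
    calc _ ≤ (4*(n:ℝ)+1) * 1 * (‖z‖^(2*n) * ((‖z‖^2)^k / k.factorial * (1 / ((2*(2*n)+1) * (2*n).factorial : ℕ)))) * (4*R)^(2*n) := by gcongr
      _ = _ := by
        have : (0:ℝ) < k.factorial := by exact_mod_cast k.factorial_pos
        have : (0:ℝ) < (2*n).factorial := by exact_mod_cast (2*n).factorial_pos
        have h5 : (4*(n:ℝ)+1) ≠ 0 := by positivity
        rw [show (((2*(2*n)+1) * (2*n).factorial : ℕ):ℝ) = (4*(n:ℝ)+1) * (2*n).factorial by push_cast; ring]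
        rw [mul_pow (4*R)]
        field_simp

lemma tt_antidiag (z θ : ℂ) (N : ℕ) : ∑ p ∈ Finset.HasAntidiagonal.antidiagonal N, tt z (cos θ) p =
    (-1) ^ N * (z * sin θ / 2) ^ (2 * N) / ((N.factorial : ℂ)) ^ 2 := by
  rw [Finset.Nat.sum_antidiagonal_eq_sum_range_succ_mk]
  have h := congrArg (eval (cos θ)) (main_poly N)
  simp only [eval_pow, eval_sub, eval_one, eval_X, eval_finsetSum, eval_mul, eval_C] at h
  have hN : (N.factorial:ℂ) ≠ 0 := by exact_mod_cast N.factorial_ne_zero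
  have hs : 1 - cos θ ^ 2 = sin θ ^ 2 := by linear_combination - Complex.sin_sq_add_cos_sq θ
  rw [hs] at h
  have e : (-1) ^ N * (z * sin θ / 2) ^ (2 * N) / ((N.factorial : ℂ)) ^ 2 =
     (-1)^N * z^(2*N) / (4^N * (N.factorial:ℂ)^2) * (sin θ^2)^N := by
    rw [div_pow, mul_pow, pow_mul 2 2 N, ← pow_mul (sin θ)]; norm_num
    field_simp
  rw [e, h, Finset.mul_sum]
  refine Finset.sum_congr rfl fun n hn => ?_
  obtain ⟨k, rfl⟩ := Nat.exists_eq_add_of_le (show n ≤ N by have := Finset.mem_range.1 hn; omega)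
  simp only [tt, jt, aC, cc, legendreC, Nat.add_sub_cancel_left]
  rw [← Q, show 2*(n+k)+2*n+1 = 2*(2*n)+2*k+1 by ring]
  have h1 := df_ne (2*(2*n)+2*k+1)
  have h2 : (k.factorial:ℂ) ≠ 0 := by exact_mod_cast k.factorial_ne_zero
  have h3 : (n.factorial:ℂ) ≠ 0 := by exact_mod_cast n.factorial_ne_zero
  have h4 : ((2*n).factorial:ℂ) ≠ 0 := by exact_mod_cast (2*n).factorial_ne_zero
  have h5 : (16:ℂ)^n = 2^(2*n)*2^(2*n) := by rw [pow_mul, ← mul_pow]; norm_num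
  have h6 : ((-1:ℂ))^n * (-1)^n = 1 := by rw [← mul_pow]; norm_num
  rw [h5]
  field_simp
  linear_combination (-((-1)^k * z^(2*(n+k)) * eval (cos θ) (Q (2*n)) * (4*n+1))) * h6

lemma antidiag_hasSum (f : ℕ × ℕ → ℂ) (hs : Summable f) :
    HasSum (fun N => ∑ p ∈ Finset.HasAntidiagonal.antidiagonal N, f p) (∑' p, f p) := by
  have := (Finset.HasAntidiagonal.sigmaAntidiagonalEquivProd (A := ℕ)).hasSum_iff.2 hs.hasSum
  refine this.sigma fun N => ?_
  exact Finset.hasSum (Finset.HasAntidiagonal.antidiagonal N) f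

lemma tt_inner (z x : ℂ) (hz : z ≠ 0) (n : ℕ) : HasSum (fun k => tt z x (n, k))
    ((4 * (n : ℂ) + 1) * cc n * sphj (2 * n) z * legendreC (2 * n) x) := by
  rw [sphj, ray_iter _ z hz]
  simp only [tt]
  exact (((jt_summable (2*n) z).hasSum.mul_left _).mul_left _).mul_right _

theorem stmt16 (z : ℂ) (hz : z ≠ 0) (θ : ℂ) :
    HasSum
      (fun n : ℕ =>
        (4 * (n : ℂ) + 1) * (((2 * n).factorial : ℂ) / (2 ^ (2 * n) * ((n.factorial : ℂ)) ^ 2)) *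
          sphj (2 * n) z * legendreC (2 * n) (Complex.cos θ))
      (besselJ0 (z * Complex.sin θ)) := by
  have hs := tt_summable z (cos θ)
  have h1 := antidiag_hasSum _ hs
  have h2 : besselJ0 (z * sin θ) = ∑' p, tt z (cos θ) p := by
    rw [← h1.tsum_eq, besselJ0]
    simp only [tt_antidiag]
  rw [h2]
  exact hs.hasSum.prod_fiberwise (tt_inner z (cos θ) hz)
end
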